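/- For every f ∈ F, the element f(c) of R is neither a right zero divisor nor left-invertible: (i) for all r ∈ R, r * f(c) = 0 implies r = 0 (i.e. right multiplication by f(c) is an injective map R → R); and (ii) there is no s ∈ R with s * f(c) = 1. -/

import Mathlib

noncomputable section

/-- The defining relation `X * Y = 1` of the Jacobson algebra. -/
inductive JRel (K : Type*) [Field K] : FreeAlgebra K (Fin 2) → FreeAlgebra K (Fin 2) → Prop
  | rel : JRel K (FreeAlgebra.ι K 0 * FreeAlgebra.ι K 1) 1

/-- The Jacobson algebra `K⟨X, Y | XY = 1⟩`. -/
abbrev Jacobson (K : Type*) [Field K] := RingQuot (JRel K)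

variable (K : Type*) [Field K]

/-- The generator `X` of the Jacobson algebra. -/
def Xg : Jacobson K := RingQuot.mkAlgHom K (JRel K) (FreeAlgebra.ι K 0)

/-- The generator `Y` of the Jacobson algebra. -/
def Yg : Jacobson K := RingQuot.mkAlgHom K (JRel K) (FreeAlgebra.ι K 1)

/-- The loop `c = Y²X`. -/
def cJ : Jacobson K := Yg K ^ 2 * Xg K

/-- `F` is the set of irreducible polynomials `f ∈ K[x]` with `f(0) = -1`. -/
def FSet : Set (Polynomial K) := {f | Irreducible f ∧ f.eval 0 = -1}

theorem J_XY : Xg K * Yg K = 1 := by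
  have h := RingQuot.mkAlgHom_rel K (JRel.rel (K := K))
  simpa [Xg, Yg] using h

theorem J_hom (L : Type*) [Field L] [Algebra K L] (a : L) (ha : a ≠ 0) :
    ∃ φ : Jacobson K →ₐ[K] L, φ (Xg K) = a⁻¹ ∧ φ (Yg K) = a := by
  refine ⟨RingQuot.liftAlgHom K ⟨FreeAlgebra.lift K ![a⁻¹, a], ?_⟩, ?_, ?_⟩
  · intro x y h
    cases h
    simp [ha]
  · simp [Xg]
  · simp [Yg]

theorem J_poly (r : Jacobson K) :
    ∃ (n : ℕ) (p : Polynomial K), r * Yg K ^ n = Polynomial.aeval (Yg K) p := by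
  obtain ⟨w, rfl⟩ := RingQuot.mkAlgHom_surjective K (JRel K) r
  induction w using FreeAlgebra.induction with
  | grade0 k => exact ⟨0, Polynomial.C k, by simp⟩
  | grade1 i =>
    fin_cases i
    · exact ⟨1, 1, by simpa [Xg] using J_XY K⟩
    · exact ⟨0, Polynomial.X, by simp [Yg]⟩
  | mul a b ha hb =>
    obtain ⟨m, q, hq⟩ := ha
    obtain ⟨n, p, hp⟩ := hb
    refine ⟨n + m, q * p, ?_⟩
    have hc : Polynomial.aeval (Yg K) p * Yg K ^ m = Yg K ^ m * Polynomial.aeval (Yg K) p := by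
      have := congrArg (Polynomial.aeval (Yg K)) (mul_comm p (Polynomial.X ^ m))
      simpa using this
    rw [map_mul, map_mul, pow_add, mul_assoc, ← mul_assoc _ (Yg K ^ n), hp, hc, ← mul_assoc, hq]
  | add a b ha hb =>
    obtain ⟨m, q, hq⟩ := ha
    obtain ⟨n, p, hp⟩ := hb
    refine ⟨m + n, q * Polynomial.X ^ n + p * Polynomial.X ^ m, ?_⟩
    rw [map_add, add_mul, pow_add, ← mul_assoc, hq, (Commute.pow_pow (Commute.refl (Yg K)) m n).eq,
      ← mul_assoc, hp]
    simp

theorem J_inj (p : Polynomial K) (h : Polynomial.aeval (Yg K) p = 0) : p = 0 := by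
  obtain ⟨φ, -, hY⟩ := J_hom K (RatFunc K) RatFunc.X RatFunc.X_ne_zero
  have h2 := congrArg φ h
  rw [← Polynomial.aeval_algHom_apply, hY, map_zero, ← RatFunc.algebraMap_X,
    Polynomial.aeval_algebraMap_apply, Polynomial.aeval_X_left_apply] at h2
  exact (map_eq_zero_iff _ (RatFunc.algebraMap_injective K)).1 h2

theorem J_c_mul_Y : cJ K * Yg K = Yg K * Yg K := by
  rw [cJ, mul_assoc, J_XY, mul_one, pow_two]

theorem J_aeval_c_mul_Y (p : Polynomial K) :
    Polynomial.aeval (cJ K) p * Yg K = Yg K * Polynomial.aeval (Yg K) p := by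
  induction p using Polynomial.induction_on' with
  | add p q hp hq => rw [map_add, map_add, add_mul, mul_add, hp, hq]
  | monomial n a =>
    have h : SemiconjBy (Yg K) (Yg K) (cJ K) := (J_c_mul_Y K).symm
    have h2 := (h.pow_right n).eq
    rw [Polynomial.aeval_monomial, Polynomial.aeval_monomial, mul_assoc, ← h2,
      Algebra.left_comm]

/-- `f(Y)` is not a right zero divisor. -/
theorem J_fY (h : Polynomial K) (u : Jacobson K)
    (hu : u = u * Polynomial.aeval (Yg K) (Polynomial.X * h)) : u = 0 := by
  have hn : ∀ n : ℕ, u = u * Polynomial.aeval (Yg K) ((Polynomial.X * h) ^ n) := by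
    intro n
    induction n with
    | zero => simp
    | succ n ih =>
      rw [pow_succ, map_mul, ← mul_assoc, ← ih]
      exact hu
  obtain ⟨n, p, hp⟩ := J_poly K u
  have h1 := hn n
  rw [mul_pow, map_mul, map_pow, Polynomial.aeval_X, ← mul_assoc, hp, ← map_mul] at h1
  have h2 := hu
  rw [h1, ← map_mul, ← sub_eq_zero, ← map_sub] at h2
  have h3 := J_inj K _ h2
  have h4 : (p * h ^ n) * (1 - Polynomial.X * h) = 0 := by rw [← h3]; ring
  rcases mul_eq_zero.1 h4 with h5 | h5
  · rw [h1, h5, map_zero]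
  · have := congrArg (Polynomial.eval 0) h5
    simp at this

/-- For every irreducible `f ∈ K[x]` with `f(0) = -1`, the element `f(c)` of the Jacobson
algebra is neither a right zero divisor nor left-invertible. -/
theorem fc_not_right_zero_divisor_not_left_invertible (f : Polynomial K) (hf : f ∈ FSet K) :
    (∀ r : Jacobson K, r * Polynomial.aeval (cJ K) f = 0 → r = 0) ∧
      ¬∃ s : Jacobson K, s * Polynomial.aeval (cJ K) f = 1 := by
  obtain ⟨hirr, h0⟩ := hf
  constructor
  · intro r hr
    have hfe : f = Polynomial.X * f.divX - 1 := by
      conv_lhs => rw [← Polynomial.X_mul_divX_add f]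
      rw [Polynomial.coeff_zero_eq_eval_zero, h0]
      simp [sub_eq_add_neg]
    generalize f.divX = h at hfe
    have hr1 : r = r * Polynomial.aeval (cJ K) (Polynomial.X * h) := by
      rw [hfe, map_sub, map_one, mul_sub, mul_one, sub_eq_zero] at hr
      exact hr.symm
    have hu : r * Yg K = 0 := by
      apply J_fY K h
      conv_lhs => rw [hr1, mul_assoc, J_aeval_c_mul_Y]
      rw [mul_assoc]
    have hc : cJ K = Yg K * (Yg K * Xg K) := by rw [cJ, pow_two, mul_assoc]
    have h2 : Polynomial.aeval (cJ K) h * cJ K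
        = Yg K * (Polynomial.aeval (Yg K) h * (Yg K * Xg K)) := by
      calc _ = Polynomial.aeval (cJ K) h * (Yg K * (Yg K * Xg K)) := congrArg _ hc
        _ = _ := by rw [← mul_assoc, J_aeval_c_mul_Y, mul_assoc]
    rw [hr1, mul_comm Polynomial.X h, map_mul, Polynomial.aeval_X, h2, ← mul_assoc r, hu,
      zero_mul]
  · rintro ⟨s, hs⟩
    haveI := Fact.mk hirr
    have hroot : AdjoinRoot.root f ≠ 0 := by
      intro h
      have h1 := AdjoinRoot.eval₂_root f
      rw [h, Polynomial.eval₂_at_zero, Polynomial.coeff_zero_eq_eval_zero, h0] at h1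
      simp at h1
    obtain ⟨φ, hX, hY⟩ := J_hom K (AdjoinRoot f) (AdjoinRoot.root f) hroot
    have hc : φ (cJ K) = AdjoinRoot.root f := by
      rw [cJ, map_mul, map_pow, hX, hY, pow_two, mul_assoc, mul_inv_cancel₀ hroot, mul_one]
    have h1 := congrArg φ hs
    rw [map_mul, ← Polynomial.aeval_algHom_apply, hc, AdjoinRoot.aeval_eq, AdjoinRoot.mk_self,
      mul_zero, map_one] at h1
    exact zero_ne_one h1
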